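/- The language {aⁿbⁿ : n ≥ 1} is the Szilard language of some labeled flat splicing system of type (3, 1) whose initial set is a regular language; that is, {aⁿbⁿ : n ≥ 1} ∈ SZLS^3_{1,REG}. -/

import Mathlib

/-- A flat splicing rule `⟨α | γ−δ | β⟩`. -/
structure FlatRule (A : Type) where
  /-- left handle α -/
  lf : List A
  /-- right handle β -/
  rt : List A
  /-- first letter γ of the inserted word (a word of length ≤ 1) -/
  ins1 : List A
  /-- last letter δ of the inserted word (a word of length ≤ 1) -/
  ins2 : List A

/-- Application of a flat splicing rule: from `u = x·α·β·y` and `v = γ·z·δ` (with `|v| ≥ 1`)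
produce `w = x·α·v·β·y`. -/
def FlatRule.Splice {A : Type} (r : FlatRule A) (u v w : List A) : Prop :=
  ∃ x y z : List A,
    u = x ++ r.lf ++ r.rt ++ y ∧
    v = r.ins1 ++ z ++ r.ins2 ∧ 1 ≤ v.length ∧
    w = x ++ r.lf ++ v ++ r.rt ++ y

/-- A labeled flat splicing system `(A, I, R, Lab)`; every rule carries a label word over `Λ`
(a single letter for Szilard/control labelings, possibly the empty word for λ-labelings). -/
structure LabeledFSS (A Λ : Type) where
  I : Set (List A)
  R : Set (FlatRule A)
  lab : FlatRule A → List Λ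
  finR : R.Finite
  insBound : ∀ r ∈ R, r.ins1.length ≤ 1 ∧ r.ins2.length ≤ 1

namespace LabeledFSS

variable {A Λ : Type} (S : LabeledFSS A Λ)

/-- Some rule of the system is applicable to the word `u` (together with some initial word). -/
def Applicable (u : List A) : Prop :=
  ∃ r ∈ S.R, ∃ v ∈ S.I, ∃ w, r.Splice u v w

/-- `S.Deriv x ls` : starting from initial words, the word `x` is derivable with label word `ls`. -/
inductive Deriv : List A → List Λ → Prop
  | start {x₀ y₀ x₁ : List A} {r : FlatRule A} :
      x₀ ∈ S.I → y₀ ∈ S.I → r ∈ S.R → r.Splice x₀ y₀ x₁ → Deriv x₁ (S.lab r)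
  | step {x y w : List A} {ls : List Λ} {r : FlatRule A} :
      Deriv x ls → y ∈ S.I → r ∈ S.R → r.Splice x y w → Deriv w (ls ++ S.lab r)

/-- The derivation language (Szilard language resp. control language) of the system:
label words of terminal derivations. -/
def derLang : Language Λ :=
  { ls | ∃ x : List A, S.Deriv x ls ∧ ¬ S.Applicable x }

/-- The system has type `(m, n)`: `m` is the maximum length of the handles `α, β`
and `n` is the maximum length of `γδ` over all rules. -/
def HasType (m n : ℕ) : Prop :=
  (∀ r ∈ S.R, r.lf.length ≤ m ∧ r.rt.length ≤ m) ∧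
  (∃ r ∈ S.R, r.lf.length = m ∨ r.rt.length = m) ∧
  (∀ r ∈ S.R, r.ins1.length + r.ins2.length ≤ n) ∧
  (∃ r ∈ S.R, r.ins1.length + r.ins2.length = n)

/-- Szilard labeling: each rule is labeled by a single letter, in a one-to-one manner. -/
def SzilardLabeled : Prop :=
  (∀ r ∈ S.R, (S.lab r).length = 1) ∧ Set.InjOn S.lab S.R

/-- Control labeling: each rule is labeled by a single letter
(distinct rules may share a label). -/
def ControlLabeled : Prop :=
  ∀ r ∈ S.R, (S.lab r).length = 1

/-- λ-control labeling: each rule is labeled by a single letter or by the empty word. -/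
def LambdaControlLabeled : Prop :=
  ∀ r ∈ S.R, (S.lab r).length ≤ 1

end LabeledFSS

/-- A two-letter alphabet `{a, b}`. -/
inductive AB : Type
  | a
  | b
deriving DecidableEq

namespace CountingSystem

/-- The word `(12)ᵏ 1 2ᵐ 3`. -/
def markedWord (k m : ℕ) : List (Fin 4) :=
  match k with
  | 0 => 1 :: (List.replicate m 2 ++ [3])
  | k + 1 => 1 :: 2 :: markedWord k m

/-- The word `(123)ʲ`. -/
def tripleWord : ℕ → List (Fin 4)
  | 0 => []
  | j + 1 => 1 :: 2 :: 3 :: tripleWord j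

/-- The word `(12)ᵏ (123)ʲ`. -/
def returnWord (k j : ℕ) : List (Fin 4) :=
  match k with
  | 0 => tripleWord j
  | k + 1 => 1 :: 2 :: returnWord k j

theorem markedWord_one (k : ℕ) : markedWord k 1 = returnWord k 1 := by
  induction k with
  | zero => rfl
  | succ k ih => simp [markedWord, returnWord, ih]

theorem markedWord_insert {k m : ℕ} {x y : List (Fin 4)}
    (h : markedWord k m = x ++ 1 :: 2 :: 2 :: y) :
    ∃ m', m = m' + 2 ∧ x ++ 1 :: 2 :: 1 :: 2 :: y = markedWord (k + 1) (m' + 1) := by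
  induction k generalizing x with
  | zero =>
    rcases x with _ | ⟨c, x⟩
    · rcases m with _ | _ | m
      · simp [markedWord] at h
      · simp [markedWord] at h
      · refine ⟨m, rfl, ?_⟩
        simp [markedWord, List.replicate_succ] at h ⊢
        exact h.symm
    · simp only [markedWord, List.cons_append, List.cons.injEq] at h
      have hmem : (1 : Fin 4) ∈ List.replicate m (2 : Fin 4) ++ [3] := by rw [h.2]; simp
      simp at hmem
  | succ k ih =>
    rcases x with _ | ⟨c, _ | ⟨d, x⟩⟩
    · cases k <;> simp [markedWord] at h
    · simp [markedWord] at h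
    · simp only [markedWord, List.cons_append, List.cons.injEq] at h
      obtain ⟨m', rfl, hm⟩ := ih h.2.2
      refine ⟨m', rfl, ?_⟩
      rw [markedWord, ← hm, ← h.1, ← h.2.1]
      rfl

theorem exists_markedWord_insert (k m : ℕ) :
    ∃ x y, markedWord k (m + 2) = x ++ 1 :: 2 :: 2 :: y := by
  induction k with
  | zero => exact ⟨[], List.replicate m 2 ++ [3], by simp [markedWord, List.replicate_succ]⟩
  | succ k ih =>
    obtain ⟨x, y, h⟩ := ih
    exact ⟨1 :: 2 :: x, y, by simp [markedWord, h]⟩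

theorem eq_one_of_markedWord {k m : ℕ} {x y : List (Fin 4)}
    (h : markedWord k m = x ++ 2 :: 1 :: 2 :: 3 :: y) : m = 1 := by
  induction k generalizing x with
  | zero =>
    rcases x with _ | ⟨c, x⟩
    · simp [markedWord] at h
    · simp only [markedWord, List.cons_append, List.cons.injEq] at h
      have hmem : (1 : Fin 4) ∈ List.replicate m (2 : Fin 4) ++ [3] := by rw [h.2]; simp
      simp at hmem
  | succ k ih =>
    rcases x with _ | ⟨c, _ | ⟨d, x⟩⟩
    · simp [markedWord] at h
    · rcases k with _ | _ | k
      · rcases m with _ | _ | m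
        · simp [markedWord] at h
        · rfl
        · simp [markedWord, List.replicate_succ] at h
      · simp [markedWord] at h
      · simp [markedWord] at h
    · simp only [markedWord, List.cons_append, List.cons.injEq] at h
      exact ih h.2.2

theorem tripleWord_ne_double (j : ℕ) (x y : List (Fin 4)) :
    tripleWord j ≠ x ++ 1 :: 2 :: 2 :: y := by
  intro h
  induction j generalizing x with
  | zero => simp [tripleWord] at h
  | succ j ih =>
    rcases x with _ | ⟨c, _ | ⟨d, _ | ⟨e, x⟩⟩⟩
    · simp [tripleWord] at h
    · simp [tripleWord] at h
    · simp [tripleWord] at h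
    · simp only [tripleWord, List.cons_append, List.cons.injEq] at h
      exact ih _ h.2.2.2

theorem returnWord_ne_double (k j : ℕ) (x y : List (Fin 4)) :
    returnWord k j ≠ x ++ 1 :: 2 :: 2 :: y := by
  intro h
  induction k generalizing x with
  | zero => exact tripleWord_ne_double j x y h
  | succ k ih =>
    rcases x with _ | ⟨c, _ | ⟨d, x⟩⟩
    · cases k <;> cases j <;> simp [returnWord, tripleWord] at h
    · simp [returnWord] at h
    · simp only [returnWord, List.cons_append, List.cons.injEq] at h
      exact ih _ h.2.2

theorem tripleWord_ne_return (j : ℕ) (x y : List (Fin 4)) :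
    tripleWord j ≠ x ++ 2 :: 1 :: 2 :: 3 :: y := by
  intro h
  induction j generalizing x with
  | zero => simp [tripleWord] at h
  | succ j ih =>
    rcases x with _ | ⟨c, _ | ⟨d, _ | ⟨e, x⟩⟩⟩
    · simp [tripleWord] at h
    · simp [tripleWord] at h
    · simp [tripleWord] at h
    · simp only [tripleWord, List.cons_append, List.cons.injEq] at h
      exact ih _ h.2.2.2

theorem returnWord_insert {k j : ℕ} {x y : List (Fin 4)}
    (h : returnWord k (j + 1) = x ++ 2 :: 1 :: 2 :: 3 :: y) :
    ∃ k', k = k' + 1 ∧ x ++ 2 :: 3 :: 1 :: 2 :: 3 :: y = returnWord k' (j + 2) := by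
  induction k generalizing x with
  | zero => exact absurd h (tripleWord_ne_return _ _ _)
  | succ k ih =>
    refine ⟨k, rfl, ?_⟩
    rcases x with _ | ⟨c, _ | ⟨d, x⟩⟩
    · simp [returnWord] at h
    · rcases k with _ | _ | k
      · simp [returnWord, tripleWord] at h ⊢
        exact ⟨h.1.symm, h.2.symm⟩
      · simp [returnWord, tripleWord] at h
      · simp [returnWord] at h
    · simp only [returnWord, List.cons_append, List.cons.injEq] at h
      obtain ⟨k', rfl, hk⟩ := ih h.2.2
      rw [returnWord, ← hk, ← h.1, ← h.2.1]
      rfl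

theorem exists_returnWord_insert (k j : ℕ) :
    ∃ x y, returnWord (k + 1) (j + 1) = x ++ 2 :: 1 :: 2 :: 3 :: y := by
  induction k with
  | zero => exact ⟨[1], tripleWord j, rfl⟩
  | succ k ih =>
    obtain ⟨x, y, h⟩ := ih
    exact ⟨1 :: 2 :: x, y, by rw [returnWord, h]; rfl⟩

/-- The automaton accepting `{1, 3} ∪ 0 1 2* 3`. -/
def initialDFA : DFA (Fin 4) (Fin 5) where
  step q c :=
    match q, c with
    | 0, 0 => 1
    | 0, 1 => 3
    | 0, 3 => 3
    | 1, 1 => 2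
    | 2, 2 => 2
    | 2, 3 => 3
    | _, _ => 4
  start := 0
  accept := {3}

theorem evalFrom_dead (l : List (Fin 4)) : initialDFA.evalFrom 4 l = 4 := by
  induction l with
  | nil => rfl
  | cons c l ih => rw [DFA.evalFrom_cons]; exact ih

theorem evalFrom_final {l : List (Fin 4)} : initialDFA.evalFrom 3 l = 3 ↔ l = [] := by
  cases l with
  | nil => simp
  | cons c l =>
    have hc : initialDFA.step 3 c = 4 := rfl
    simp [DFA.evalFrom_cons, hc, evalFrom_dead]

theorem evalFrom_loop {l : List (Fin 4)} :
    initialDFA.evalFrom 2 l = 3 ↔ ∃ m, l = List.replicate m 2 ++ [3] := by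
  induction l with
  | nil => simp
  | cons c l ih =>
    rw [DFA.evalFrom_cons]
    constructor
    · intro h
      fin_cases c
      · exact absurd ((evalFrom_dead l).symm.trans h) (by decide)
      · exact absurd ((evalFrom_dead l).symm.trans h) (by decide)
      · obtain ⟨m, rfl⟩ := ih.1 h
        exact ⟨m + 1, rfl⟩
      · exact ⟨0, by rw [evalFrom_final.1 h]; rfl⟩
    · rintro ⟨_ | m, h⟩
      · simp at h
        rw [h.1, h.2]
        rfl
      · simp [List.replicate_succ] at h
        rw [h.1]
        exact ih.2 ⟨m, h.2⟩

theorem mem_initialDFA_accepts {l : List (Fin 4)} :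
    l ∈ initialDFA.accepts ↔ l = [1] ∨ l = [3] ∨ ∃ m, l = 0 :: markedWord 0 m := by
  change initialDFA.evalFrom 0 l = 3 ↔ _
  constructor
  · intro h
    rcases l with _ | ⟨c, l⟩
    · exact absurd h (by decide)
    rw [DFA.evalFrom_cons] at h
    fin_cases c
    · rcases l with _ | ⟨d, l⟩
      · exact absurd h (by decide)
      rw [DFA.evalFrom_cons] at h
      fin_cases d
      · exact absurd ((evalFrom_dead l).symm.trans h) (by decide)
      · obtain ⟨m, rfl⟩ := evalFrom_loop.1 h
        exact .inr (.inr ⟨m, rfl⟩)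
      · exact absurd ((evalFrom_dead l).symm.trans h) (by decide)
      · exact absurd ((evalFrom_dead l).symm.trans h) (by decide)
    · exact .inl (by rw [evalFrom_final.1 h]; rfl)
    · exact absurd ((evalFrom_dead l).symm.trans h) (by decide)
    · exact .inr (.inl (by rw [evalFrom_final.1 h]; rfl))
  · rintro (rfl | rfl | ⟨m, rfl⟩)
    · rfl
    · rfl
    · exact evalFrom_loop.2 ⟨m, rfl⟩

/-- The rule `⟨12 | 1−λ | 2⟩`, which moves the mark `1` to the right. -/
def forwardRule : FlatRule (Fin 4) := ⟨[1, 2], [2], [1], []⟩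

/-- The rule `⟨2 | 3−λ | 123⟩`, which moves the mark `3` to the left. -/
def backwardRule : FlatRule (Fin 4) := ⟨[2], [1, 2, 3], [3], []⟩

open Classical in
/-- The labeled flat splicing system with Szilard language `{aⁿbⁿ : n ≥ 1}`. -/
noncomputable def system : LabeledFSS (Fin 4) AB where
  I := initialDFA.accepts
  R := {forwardRule, backwardRule}
  lab r := if r = forwardRule then [AB.a] else [AB.b]
  finR := Set.toFinite _
  insBound := by rintro r (rfl | rfl) <;> simp [forwardRule, backwardRule]

theorem backwardRule_ne : backwardRule ≠ forwardRule := by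
  simp [forwardRule, backwardRule]

theorem lab_forwardRule : system.lab forwardRule = [AB.a] := by simp [system]

theorem lab_backwardRule : system.lab backwardRule = [AB.b] := by
  simp [system, backwardRule_ne]

theorem splice_forwardRule {u v w : List (Fin 4)} (hv : v ∈ system.I) :
    forwardRule.Splice u v w ↔ v = [1] ∧
      ∃ x y, u = x ++ 1 :: 2 :: 2 :: y ∧ w = x ++ 1 :: 2 :: 1 :: 2 :: y := by
  constructor
  · rintro ⟨x, y, z, rfl, hv', -, rfl⟩
    rcases mem_initialDFA_accepts.1 hv with rfl | rfl | ⟨m, rfl⟩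
    · exact ⟨rfl, x, y, by simp [forwardRule], by simp [forwardRule]⟩
    · simp [forwardRule] at hv'
    · simp [forwardRule] at hv'
  · rintro ⟨rfl, x, y, rfl, rfl⟩
    exact ⟨x, y, [], by simp [forwardRule], by simp [forwardRule], by simp,
      by simp [forwardRule]⟩

theorem splice_backwardRule {u v w : List (Fin 4)} (hv : v ∈ system.I) :
    backwardRule.Splice u v w ↔ v = [3] ∧
      ∃ x y, u = x ++ 2 :: 1 :: 2 :: 3 :: y ∧ w = x ++ 2 :: 3 :: 1 :: 2 :: 3 :: y := by
  constructor
  · rintro ⟨x, y, z, rfl, hv', -, rfl⟩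
    rcases mem_initialDFA_accepts.1 hv with rfl | rfl | ⟨m, rfl⟩
    · simp [backwardRule] at hv'
    · exact ⟨rfl, x, y, by simp [backwardRule], by simp [backwardRule]⟩
    · simp [backwardRule] at hv'
  · rintro ⟨rfl, x, y, rfl, rfl⟩
    exact ⟨x, y, [], by simp [backwardRule], by simp [backwardRule], by simp,
      by simp [backwardRule]⟩

theorem one_mem : [1] ∈ system.I := mem_initialDFA_accepts.2 (.inl rfl)

theorem three_mem : [3] ∈ system.I := mem_initialDFA_accepts.2 (.inr (.inl rfl))

theorem markedWord_mem (m : ℕ) : 0 :: markedWord 0 m ∈ system.I :=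
  mem_initialDFA_accepts.2 (.inr (.inr ⟨m, rfl⟩))

/-- One splicing step with an initial word, together with its label. -/
def Step (u : List (Fin 4)) (c : AB) (w : List (Fin 4)) : Prop :=
  match c with
  | AB.a => ∃ x y, u = x ++ 1 :: 2 :: 2 :: y ∧ w = x ++ 1 :: 2 :: 1 :: 2 :: y
  | AB.b => ∃ x y, u = x ++ 2 :: 1 :: 2 :: 3 :: y ∧ w = x ++ 2 :: 3 :: 1 :: 2 :: 3 :: y

theorem step_iff {u w : List (Fin 4)} {c : AB} :
    Step u c w ↔ ∃ v ∈ system.I, ∃ r ∈ system.R, system.lab r = [c] ∧ r.Splice u v w := by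
  constructor
  · intro h
    cases c with
    | a => exact ⟨[1], one_mem, forwardRule, .inl rfl, lab_forwardRule,
        (splice_forwardRule one_mem).2 ⟨rfl, h⟩⟩
    | b => exact ⟨[3], three_mem, backwardRule, .inr rfl, lab_backwardRule,
        (splice_backwardRule three_mem).2 ⟨rfl, h⟩⟩
  · rintro ⟨v, hv, r, rfl | rfl, hl, h⟩
    · rw [lab_forwardRule] at hl
      obtain rfl : AB.a = c := by simpa using hl
      exact ((splice_forwardRule hv).1 h).2
    · rw [lab_backwardRule] at hl
      obtain rfl : AB.b = c := by simpa using hl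
      exact ((splice_backwardRule hv).1 h).2

theorem exists_lab_eq {r : FlatRule (Fin 4)} (hr : r ∈ system.R) : ∃ c, system.lab r = [c] := by
  rcases hr with rfl | rfl
  · exact ⟨_, lab_forwardRule⟩
  · exact ⟨_, lab_backwardRule⟩

theorem applicable_iff {u : List (Fin 4)} : system.Applicable u ↔ ∃ c w, Step u c w := by
  constructor
  · rintro ⟨r, hr, v, hv, w, h⟩
    obtain ⟨c, hc⟩ := exists_lab_eq hr
    exact ⟨c, w, step_iff.2 ⟨v, hv, r, hr, hc, h⟩⟩
  · rintro ⟨c, w, h⟩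
    obtain ⟨v, hv, r, hr, -, h⟩ := step_iff.1 h
    exact ⟨r, hr, v, hv, w, h⟩

theorem deriv_step {u w : List (Fin 4)} {ls : List AB} {c : AB}
    (hu : (u ∈ system.I ∧ ls = []) ∨ system.Deriv u ls) (h : Step u c w) :
    system.Deriv w (ls ++ [c]) := by
  obtain ⟨v, hv, r, hr, hl, h⟩ := step_iff.1 h
  rw [← hl]
  rcases hu with ⟨hu, rfl⟩ | hu
  · exact .start hu hv hr h
  · exact .step hu hv hr h

theorem step_markedWord (k m : ℕ) :
    Step (0 :: markedWord k (m + 2)) AB.a (0 :: markedWord (k + 1) (m + 1)) := by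
  obtain ⟨x, y, h⟩ := exists_markedWord_insert k m
  obtain ⟨m', hm, h'⟩ := markedWord_insert h
  obtain rfl : m = m' := by omega
  exact ⟨0 :: x, y, by simp [h], by simp [h']⟩

theorem step_returnWord (k j : ℕ) :
    Step (0 :: returnWord (k + 1) (j + 1)) AB.b (0 :: returnWord k (j + 2)) := by
  obtain ⟨x, y, h⟩ := exists_returnWord_insert k j
  obtain ⟨k', hk, h'⟩ := returnWord_insert h
  obtain rfl : k = k' := by omega
  exact ⟨0 :: x, y, by rw [h]; rfl, by rw [← h']; rfl⟩

theorem step_markedWord_inv {k m : ℕ} {c : AB} {w : List (Fin 4)}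
    (h : Step (0 :: markedWord k m) c w) :
    (∃ m', m = m' + 2 ∧ c = AB.a ∧ w = 0 :: markedWord (k + 1) (m' + 1)) ∨ m = 1 := by
  cases c with
  | a =>
    obtain ⟨x, y, hu, rfl⟩ := h
    rcases x with _ | ⟨d, x⟩
    · simp at hu
    simp only [List.cons_append, List.cons.injEq] at hu
    obtain ⟨m', hm, hw⟩ := markedWord_insert hu.2
    exact .inl ⟨m', hm, rfl, by rw [← hw, hu.1]; rfl⟩
  | b =>
    obtain ⟨x, y, hu, rfl⟩ := h
    rcases x with _ | ⟨d, x⟩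
    · simp at hu
    simp only [List.cons_append, List.cons.injEq] at hu
    exact .inr (eq_one_of_markedWord hu.2)

theorem step_returnWord_inv {k j : ℕ} {c : AB} {w : List (Fin 4)}
    (h : Step (0 :: returnWord k (j + 1)) c w) :
    ∃ k', k = k' + 1 ∧ c = AB.b ∧ w = 0 :: returnWord k' (j + 2) := by
  cases c with
  | a =>
    obtain ⟨x, y, hu, rfl⟩ := h
    rcases x with _ | ⟨d, x⟩
    · simp at hu
    simp only [List.cons_append, List.cons.injEq] at hu
    exact absurd hu.2 (returnWord_ne_double _ _ _ _)
  | b =>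
    obtain ⟨x, y, hu, rfl⟩ := h
    rcases x with _ | ⟨d, x⟩
    · simp at hu
    simp only [List.cons_append, List.cons.injEq] at hu
    obtain ⟨k', hk, hw⟩ := returnWord_insert hu.2
    exact ⟨k', hk, rfl, by rw [← hw, hu.1]; rfl⟩

/-- The shape of a word derived with label word `ls`. -/
def Reached (x : List (Fin 4)) (ls : List AB) : Prop :=
  (∃ k m, x = 0 :: markedWord k (m + 2) ∧ ls = List.replicate k AB.a) ∨
  ∃ k j, x = 0 :: returnWord k (j + 1) ∧
    ls = List.replicate (k + j) AB.a ++ List.replicate j AB.b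

theorem Reached.step {x w : List (Fin 4)} {ls : List AB} {c : AB} (hx : Reached x ls)
    (h : Step x c w) : Reached w (ls ++ [c]) := by
  rcases hx with ⟨k, m, rfl, rfl⟩ | ⟨k, j, rfl, rfl⟩
  · rcases step_markedWord_inv h with ⟨m', hm, rfl, rfl⟩ | hm
    · rcases m' with _ | m'
      · refine .inr ⟨k + 1, 0, by rw [markedWord_one], ?_⟩
        simp [List.replicate_succ']
      · exact .inl ⟨k + 1, m', rfl, by simp [List.replicate_succ']⟩
    · omega
  · obtain ⟨k', rfl, rfl, rfl⟩ := step_returnWord_inv h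
    refine .inr ⟨k', j + 1, rfl, ?_⟩
    rw [List.append_assoc, ← List.replicate_succ', show k' + 1 + j = k' + (j + 1) by omega]

theorem Reached.of_step_initial {x w : List (Fin 4)} {c : AB} (hx : x ∈ system.I)
    (h : Step x c w) : Reached w [c] := by
  rcases mem_initialDFA_accepts.1 hx with rfl | rfl | ⟨_ | _ | m, rfl⟩
  · cases c <;> obtain ⟨x, y, hu, -⟩ := h <;> (have hl := congrArg List.length hu; simp at hl; omega)
  · cases c <;> obtain ⟨x, y, hu, -⟩ := h <;> (have hl := congrArg List.length hu; simp at hl; omega)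
  · rcases step_markedWord_inv h with ⟨m', hm, -⟩ | hm <;> omega
  · rw [markedWord_one] at h
    obtain ⟨k', hk, -⟩ := step_returnWord_inv h
    omega
  · exact Reached.step (ls := []) (.inl ⟨0, m, rfl, rfl⟩) h

theorem reached_of_deriv {x : List (Fin 4)} {ls : List AB} (h : system.Deriv x ls) :
    Reached x ls ∧ ls ≠ [] := by
  induction h with
  | start hx hy hr hs =>
    obtain ⟨c, hc⟩ := exists_lab_eq hr
    rw [hc]
    exact ⟨Reached.of_step_initial hx (step_iff.2 ⟨_, hy, _, hr, hc, hs⟩), by simp⟩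
  | step _ hy hr hs ih =>
    obtain ⟨c, hc⟩ := exists_lab_eq hr
    rw [hc]
    exact ⟨ih.1.step (step_iff.2 ⟨_, hy, _, hr, hc, hs⟩), by simp⟩

theorem deriv_markedWord (k m : ℕ) :
    system.Deriv (0 :: markedWord (k + 1) (m + 1)) (List.replicate (k + 1) AB.a) := by
  induction k generalizing m with
  | zero => exact deriv_step (.inl ⟨markedWord_mem (m + 2), rfl⟩) (step_markedWord 0 m)
  | succ k ih =>
    rw [List.replicate_succ']
    exact deriv_step (.inr (ih (m + 1))) (step_markedWord (k + 1) m)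

theorem deriv_returnWord (k j : ℕ) (hkj : 1 ≤ k + j) :
    system.Deriv (0 :: returnWord k (j + 1))
      (List.replicate (k + j) AB.a ++ List.replicate j AB.b) := by
  induction j generalizing k with
  | zero =>
    obtain ⟨k, rfl⟩ := Nat.exists_eq_add_of_le' hkj
    simpa [markedWord_one] using deriv_markedWord k 0
  | succ j ih =>
    have h := deriv_step (.inr (ih (k + 1) (by omega))) (step_returnWord k j)
    rwa [List.append_assoc, ← List.replicate_succ',
      show k + 1 + j = k + (j + 1) by omega] at h

theorem derLang_system : system.derLang = { w : List AB | ∃ k : ℕ, 1 ≤ k ∧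
    w = List.replicate k AB.a ++ List.replicate k AB.b } := by
  ext ls
  constructor
  · rintro ⟨x, hx, hterm⟩
    rw [applicable_iff] at hterm
    obtain ⟨⟨k, m, rfl, rfl⟩ | ⟨_ | k, j, rfl, rfl⟩, hne⟩ := reached_of_deriv hx
    · exact absurd ⟨_, _, step_markedWord k m⟩ hterm
    · refine ⟨j, ?_, by rw [Nat.zero_add]⟩
      rcases j with _ | j
      · simp at hne
      · omega
    · exact absurd ⟨_, _, step_returnWord k j⟩ hterm
  · rintro ⟨k, hk, rfl⟩
    refine ⟨0 :: returnWord 0 (k + 1), ?_, ?_⟩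
    · simpa using deriv_returnWord 0 k (by omega)
    · rw [applicable_iff]
      rintro ⟨c, w, h⟩
      obtain ⟨k', hk', -⟩ := step_returnWord_inv h
      omega

theorem szilardLabeled_system : system.SzilardLabeled := by
  refine ⟨?_, ?_⟩
  · rintro r (rfl | rfl)
    · rw [lab_forwardRule]; rfl
    · rw [lab_backwardRule]; rfl
  · rintro r (rfl | rfl) s (rfl | rfl) h <;>
      simp_all [lab_forwardRule, lab_backwardRule]

theorem hasType_system : system.HasType 3 1 := by
  refine ⟨?_, ⟨backwardRule, .inr rfl, .inr rfl⟩, ?_, ⟨forwardRule, .inl rfl, rfl⟩⟩ <;>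
    rintro r (rfl | rfl) <;> simp [forwardRule, backwardRule]

end CountingSystem

/-- The language `{aⁿbⁿ : n ≥ 1}` is the Szilard language of some labeled flat splicing
system of type `(3, 1)` whose initial set is a regular language. -/
theorem stmt7 :
    ∃ (A : Type) (_ : Finite A) (S : LabeledFSS A AB),
      S.SzilardLabeled ∧ Language.IsRegular (S.I : Language A) ∧ S.HasType 3 1 ∧
      S.derLang = { w : List AB | ∃ k : ℕ, 1 ≤ k ∧
        w = List.replicate k AB.a ++ List.replicate k AB.b } := by
  exact ⟨Fin 4, inferInstance, CountingSystem.system, CountingSystem.szilardLabeled_system,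
    ⟨Fin 5, inferInstance, CountingSystem.initialDFA, rfl⟩, CountingSystem.hasType_system,
    CountingSystem.derLang_system⟩
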